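/- Let p > 2 and let q = p/(p−1) be the Hölder conjugate of p. There exists a constant C > 0 such that for every ε ∈ (0, 1] and every smooth compactly supported f: ℝ³ → ℝ, ∫ |f|^q dμ ≤ C ( ε ∫ |∇_ℍ f|^q dμ + ε⁻¹ ∫ |x|^q |f|^q dμ ), where |∇_ℍ f|^q = ((X₁f)² + (X₂f)²)^{q/2}. -/

import Mathlib

open MeasureTheory

/-- Horizontal vector field `X₁ = ∂_{x₁} - (x₂/2) ∂_t` on the Heisenberg group `ℝ³`. -/
noncomputable def X1 (f : ℝ × ℝ × ℝ → ℝ) (w : ℝ × ℝ × ℝ) : ℝ :=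
  fderiv ℝ f w (1, 0, -(w.2.1) / 2)

/-- Horizontal vector field `X₂ = ∂_{x₂} + (x₁/2) ∂_t` on the Heisenberg group `ℝ³`. -/
noncomputable def X2 (f : ℝ × ℝ × ℝ → ℝ) (w : ℝ × ℝ × ℝ) : ℝ :=
  fderiv ℝ f w (0, 1, w.1 / 2)

/-- The Kaplan norm `N(x₁,x₂,t) = ((x₁² + x₂²)² + 16 t²)^{1/4}` on the Heisenberg group. -/
noncomputable def KaplanH (w : ℝ × ℝ × ℝ) : ℝ :=
  ((w.1 ^ 2 + w.2.1 ^ 2) ^ 2 + 16 * w.2.2 ^ 2) ^ ((1 : ℝ) / 4)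

/-- The probability measure `dμ = Z⁻¹ e^{-N^p} dξ` on the Heisenberg group `ℝ³`. -/
noncomputable def muH (p : ℝ) : Measure (ℝ × ℝ × ℝ) :=
  volume.withDensity (fun w => ENNReal.ofReal
    ((∫ v : ℝ × ℝ × ℝ, Real.exp (-(KaplanH v) ^ p))⁻¹ * Real.exp (-(KaplanH w) ^ p)))

/-- The profile `y ↦ y^{m} / (4 (1 + y^{m+1}))` with `m = 2j + 1`, a smooth substitute for
`y ↦ 1 / (4 y)`. -/
noncomputable def profile (j : ℕ) (y : ℝ) : ℝ := y ^ (2 * j + 1) / (4 * (1 + y ^ (2 * j + 2)))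

theorem one_add_pow_even_pos (j : ℕ) (y : ℝ) : 0 < 1 + y ^ (2 * j + 2) := by
  have : 0 ≤ y ^ (2 * j + 2) := Even.pow_nonneg ⟨j + 1, by ring⟩ y
  linarith

theorem contDiff_profile (j : ℕ) : ContDiff ℝ 1 (profile j) := by
  unfold profile
  refine ContDiff.div (by fun_prop) (by fun_prop) fun y => ?_
  have := one_add_pow_even_pos j y
  positivity

theorem profile_nonneg (j : ℕ) {y : ℝ} (hy : 0 ≤ y) : 0 ≤ profile j y := by
  unfold profile; positivity

theorem four_mul_profile_mul (j : ℕ) (y : ℝ) :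
    1 - 4 * profile j y * y = 1 / (1 + y ^ (2 * j + 2)) := by
  have := one_add_pow_even_pos j y
  unfold profile
  field_simp
  ring

theorem exists_hasDerivAt_profile (j : ℕ) {y : ℝ} (hy : 0 ≤ y) :
    ∃ d, HasDerivAt (profile j) d y ∧ y * d ≤ (2 * j + 1) * profile j y := by
  have hpos := one_add_pow_even_pos j y
  have h := (hasDerivAt_pow (2 * j + 1) y).div
    (((hasDerivAt_pow (2 * j + 2) y).const_add 1).const_mul 4) (by positivity)
  refine ⟨_, h, ?_⟩
  unfold profile
  rw [← sub_nonneg]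
  have : (2 * (j : ℝ) + 1) * (y ^ (2 * j + 1) / (4 * (1 + y ^ (2 * j + 2)))) -
      y * (((2 * j + 1 : ℕ) * y ^ (2 * j + 1 - 1) * (4 * (1 + y ^ (2 * j + 2))) -
        y ^ (2 * j + 1) * (4 * ((2 * j + 2 : ℕ) * y ^ (2 * j + 2 - 1)))) /
        (4 * (1 + y ^ (2 * j + 2))) ^ 2)
      = (2 * j + 2) * (y ^ (2 * j + 1)) ^ 2 * y / (4 * (1 + y ^ (2 * j + 2)) ^ 2) := by
    simp only [Nat.add_sub_cancel, show 2 * j + 2 - 1 = 2 * j + 1 by omega]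
    push_cast
    field_simp
    ring
  rw [this]
  positivity

theorem rpow_le_one_add_rpow {y a b : ℝ} (hy : 0 ≤ y) (ha : 0 ≤ a) (hab : a ≤ b) :
    y ^ a ≤ 1 + y ^ b := by
  rcases le_total y 1 with h | h
  · linarith [Real.rpow_le_one hy h ha, Real.rpow_nonneg hy b]
  · linarith [Real.rpow_le_rpow_of_exponent_le h hab]

theorem sq_le_rpow_mul_rpow {s R q : ℝ} (hs : 0 ≤ s) (hsR : s ≤ R) (hq0 : 0 < q) (hq : q < 4) :
    s ^ 2 ≤ s ^ (q / 2) * R ^ (2 - q / 2) := by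
  have h1 : s ^ 2 = s ^ (q / 2) * s ^ (2 - q / 2) := by
    rw [← Real.rpow_add_of_nonneg hs (by linarith) (by linarith), ← Real.rpow_natCast]
    congr 1
    push_cast
    ring
  rw [h1]
  gcongr
  linarith

theorem sq_mul_rpow_div_le {s R q a b : ℝ} (hs : 0 ≤ s) (hsR : s ≤ R) (hq0 : 0 < q) (hq : q < 4)
    (ha : 0 ≤ a + (2 - q / 2)) (hab : a + (2 - q / 2) ≤ b) :
    s ^ 2 * R ^ a * (1 / (1 + R ^ b)) ≤ s ^ (q / 2) := by
  have hR : 0 ≤ R := hs.trans hsR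
  have hRb : 0 ≤ R ^ b := Real.rpow_nonneg hR b
  rcases hR.eq_or_lt with h0 | hpos
  · have : s = 0 := by linarith
    rw [this]
    simp
    positivity
  rw [mul_one_div, div_le_iff₀ (by positivity)]
  calc s ^ 2 * R ^ a ≤ s ^ (q / 2) * R ^ (2 - q / 2) * R ^ a := by
        gcongr; exact sq_le_rpow_mul_rpow hs hsR hq0 hq
    _ = s ^ (q / 2) * R ^ (a + (2 - q / 2)) := by
        rw [mul_assoc, ← Real.rpow_add hpos, add_comm]
    _ ≤ _ := by gcongr; exact rpow_le_one_add_rpow hR ha hab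

/-- Lower bound for the divergence, with respect to `e^{-N^p} dξ`, of the test field. -/
theorem divergence_lower_bound {p q e ε s R k d : ℝ} {j : ℕ} (hp : 2 < p) (hq1 : 1 < q)
    (hq2 : q < 2) (hj : p / 2 ≤ 4 * j + 4) (hε0 : 0 < ε) (hε1 : ε ≤ 1) (he : e = ε ^ (2 / q))
    (hs : 0 ≤ s) (hsR : s ≤ R) (hk : k = profile j (R ^ 2))
    (hd : R ^ 2 * d ≤ (2 * j + 1) * k) :
    1 / 2 - (p + 8 * j + 13) * (ε⁻¹ * s ^ (q / 2)) ≤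
      -e / (e + s) ^ 2 * (2 * s - 8 * k * s ^ 3) +
        e / (e + s) * (2 - 16 * s ^ 2 * (R ^ 2 * d + 2 * k)) -
        p * R ^ (p / 2 - 2) * s ^ 2 * (e / (e + s)) * (1 - 4 * k * R ^ 2) := by
  have hR : 0 ≤ R := hs.trans hsR
  have he0 : 0 < e := he ▸ Real.rpow_pos_of_pos hε0 _
  have hk0 : 0 ≤ k := hk ▸ profile_nonneg j (by positivity)
  set Y := s ^ (q / 2) with hY
  have hY0 : 0 ≤ Y := Real.rpow_nonneg hs _
  have hYε : Y ≤ ε⁻¹ * Y := le_mul_of_one_le_left hY0 ((one_le_inv₀ hε0).2 hε1)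
  have hpow : (R ^ 2) ^ (2 * j + 2) = R ^ ((4 * j + 4 : ℕ) : ℝ) := by
    rw [Real.rpow_natCast, ← pow_mul]; congr 1; ring
  have hT : p * R ^ (p / 2 - 2) * s ^ 2 * (1 - 4 * k * R ^ 2) ≤ p * Y := by
    rw [hk, four_mul_profile_mul, hpow]
    have := sq_mul_rpow_div_le (a := p / 2 - 2) (b := ((4 * j + 4 : ℕ) : ℝ)) hs hsR
      (by linarith : 0 < q) (by linarith) (by linarith) (by push_cast; linarith)
    nlinarith
  have hD : s ^ 2 * k ≤ Y / 4 := by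
    have := sq_mul_rpow_div_le (a := ((4 * j + 2 : ℕ) : ℝ)) (b := ((4 * j + 4 : ℕ) : ℝ)) hs hsR
      (by linarith : 0 < q) (by linarith)
      (by linarith [Nat.cast_nonneg (α := ℝ) (4 * j + 2)]) (by push_cast; linarith)
    have hk' : s ^ 2 * k =
        s ^ 2 * R ^ ((4 * j + 2 : ℕ) : ℝ) * (1 / (1 + R ^ ((4 * j + 4 : ℕ) : ℝ))) / 4 := by
      rw [hk, profile, hpow, Real.rpow_natCast R (4 * j + 2), ← pow_mul,
        show 2 * (2 * j + 1) = 4 * j + 2 by ring]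
      field_simp
    rw [hk']
    linarith
  have hφ0 : 0 ≤ e / (e + s) := by positivity
  have hφ1 : e / (e + s) ≤ 1 := (div_le_one (by positivity)).2 (by linarith)
  have hY2 : ∀ A B : ℝ, 0 ≤ B → A ≤ B * Y → e / (e + s) * A ≤ B * Y := fun A B hB h =>
    (mul_le_mul_of_nonneg_left h hφ0).trans (mul_le_of_le_one_left (by positivity) hφ1)
  have h1 := hY2 _ _ (by linarith) hT
  have h2 := hY2 (16 * s ^ 2 * (R ^ 2 * d + 2 * k)) (4 * (2 * j + 3)) (by positivity) (by
    have : 16 * s ^ 2 * (R ^ 2 * d + 2 * k) ≤ 16 * s ^ 2 * ((2 * j + 1) * k + 2 * k) := by gcongr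
    have h3 : (2 * (j : ℝ) + 3) * (s ^ 2 * k) ≤ (2 * j + 3) * (Y / 4) := by gcongr
    nlinarith)
  have h3 : 0 ≤ e / (e + s) ^ 2 * (8 * k * s ^ 3) := by positivity
  have h4 : 1 / 2 - ε⁻¹ * Y ≤ 2 * (e / (e + s)) ^ 2 := by
    rcases le_total s e with h | h
    · have : 1 / 2 ≤ e / (e + s) := by
        rw [div_le_div_iff₀ (by norm_num) (by positivity)]; linarith
      have : 0 ≤ ε⁻¹ * Y := by positivity
      nlinarith
    · have h5 : ε ≤ Y := by
        calc ε = e ^ (q / 2) := by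
              rw [he, ← Real.rpow_mul hε0.le, show 2 / q * (q / 2) = 1 by field_simp, Real.rpow_one]
          _ ≤ Y := Real.rpow_le_rpow he0.le h (by linarith)
      have : 1 ≤ ε⁻¹ * Y := by
        rw [← div_eq_inv_mul, one_le_div hε0]; exact h5
      nlinarith [sq_nonneg (e / (e + s))]
  have h5 : -e / (e + s) ^ 2 * (2 * s - 8 * k * s ^ 3) + e / (e + s) * 2 =
      2 * (e / (e + s)) ^ 2 + e / (e + s) ^ 2 * (8 * k * s ^ 3) := by
    have : e + s ≠ 0 := by positivity
    field_simp
    ring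
  have h6 : (p + 8 * j + 12) * Y ≤ (p + 8 * j + 12) * (ε⁻¹ * Y) := by gcongr
  linarith

/-- The form of Young's inequality used to absorb the cross term. -/
theorem young_cross_term {q u v : ℝ} (hq1 : 1 < q) (hq2 : q < 2) (hu : 0 ≤ u) (hv : 0 ≤ v) :
    q * (u * v ^ (q - 1)) ≤ 4 * u ^ q + v ^ q / 4 := by
  have hc : q.HolderConjugate (q / (q - 1)) := Real.HolderConjugate.conjExponent hq1
  have h := Real.young_inequality_of_nonneg (a := 2 * u) (b := v ^ (q - 1) / 2) (by positivity)
    (by positivity) hc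
  have hq10 : 0 < q - 1 := by linarith
  have hr : 2 ≤ q / (q - 1) := by rw [le_div_iff₀ hq10]; linarith
  rw [Real.mul_rpow (by norm_num) hu, Real.div_rpow (by positivity) (by norm_num),
    ← Real.rpow_mul hv, show (q - 1) * (q / (q - 1)) = q by field_simp] at h
  have h2 : (2 : ℝ) ^ q ≤ 4 := by
    calc (2 : ℝ) ^ q ≤ 2 ^ (2 : ℝ) := Real.rpow_le_rpow_of_exponent_le (by norm_num) hq2.le
      _ = 4 := by norm_num
  have h4 : (4 : ℝ) ≤ 2 ^ (q / (q - 1)) := by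
    calc (4 : ℝ) = 2 ^ (2 : ℝ) := by norm_num
      _ ≤ _ := Real.rpow_le_rpow_of_exponent_le (by norm_num) hr
  have huq : 0 ≤ u ^ q := Real.rpow_nonneg hu q
  have hvq : 0 ≤ v ^ q := Real.rpow_nonneg hv q
  have h5 : v ^ q / 2 ^ (q / (q - 1)) ≤ v ^ q / 4 := by gcongr
  calc q * (u * v ^ (q - 1)) = q * (2 * u * (v ^ (q - 1) / 2)) := by ring
    _ ≤ q * (2 ^ q * u ^ q / q + v ^ q / 2 ^ (q / (q - 1)) / (q / (q - 1))) := by gcongr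
    _ = 2 ^ q * u ^ q + (q - 1) * (v ^ q / 2 ^ (q / (q - 1))) := by
        have : q - 1 ≠ 0 := hq10.ne'
        field_simp
    _ ≤ 4 * u ^ q + 1 * (v ^ q / 4) := by gcongr; linarith
    _ = _ := by ring

open ContinuousLinearMap in
/-- First coordinate as a continuous linear map. -/
noncomputable def dx₁ : ℝ × ℝ × ℝ →L[ℝ] ℝ := fst ℝ ℝ (ℝ × ℝ)

open ContinuousLinearMap in
/-- Second coordinate as a continuous linear map. -/
noncomputable def dx₂ : ℝ × ℝ × ℝ →L[ℝ] ℝ := (fst ℝ ℝ ℝ).comp (snd ℝ ℝ (ℝ × ℝ))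

open ContinuousLinearMap in
/-- Third coordinate as a continuous linear map. -/
noncomputable def dt : ℝ × ℝ × ℝ →L[ℝ] ℝ := (snd ℝ ℝ ℝ).comp (snd ℝ ℝ (ℝ × ℝ))

@[simp] theorem dx₁_apply (w : ℝ × ℝ × ℝ) : dx₁ w = w.1 := rfl
@[simp] theorem dx₂_apply (w : ℝ × ℝ × ℝ) : dx₂ w = w.2.1 := rfl
@[simp] theorem dt_apply (w : ℝ × ℝ × ℝ) : dt w = w.2.2 := rfl

/-- The squared horizontal length `|x|²`. -/
def horizSq (w : ℝ × ℝ × ℝ) : ℝ := w.1 ^ 2 + w.2.1 ^ 2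

/-- The fourth power of the Kaplan norm. -/
def kaplanFourth (w : ℝ × ℝ × ℝ) : ℝ := horizSq w ^ 2 + 16 * w.2.2 ^ 2

/-- The `X₁`-derivative of `kaplanFourth`. -/
def kaplanGrad₁ (w : ℝ × ℝ × ℝ) : ℝ := 4 * horizSq w * w.1 - 16 * w.2.2 * w.2.1

/-- The `X₂`-derivative of `kaplanFourth`. -/
def kaplanGrad₂ (w : ℝ × ℝ × ℝ) : ℝ := 4 * horizSq w * w.2.1 + 16 * w.2.2 * w.1

theorem hasFDerivAt_horizSq (w : ℝ × ℝ × ℝ) :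
    HasFDerivAt horizSq ((2 * w.1) • dx₁ + (2 * w.2.1) • dx₂) w := by
  convert! (dx₁.hasFDerivAt (x := w)).pow 2 |>.add ((dx₂.hasFDerivAt (x := w)).pow 2) using 1
  simp

theorem hasFDerivAt_kaplanFourth (w : ℝ × ℝ × ℝ) :
    HasFDerivAt kaplanFourth ((2 * horizSq w) • ((2 * w.1) • dx₁ + (2 * w.2.1) • dx₂) +
      (32 * w.2.2) • dt) w := by
  convert! (hasFDerivAt_horizSq w).pow 2 |>.add (((dt.hasFDerivAt (x := w)).pow 2).const_mul 16)
    using 1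
  simp [smul_smul]
  ring_nf

theorem hasFDerivAt_kaplanGrad₁ (w : ℝ × ℝ × ℝ) :
    HasFDerivAt kaplanGrad₁ ((4 * horizSq w) • dx₁ +
      (4 * w.1) • ((2 * w.1) • dx₁ + (2 * w.2.1) • dx₂) -
      ((16 * w.2.2) • dx₂ + (16 * w.2.1) • dt)) w := by
  convert! (((hasFDerivAt_horizSq w).const_mul 4).mul (dx₁.hasFDerivAt (x := w))).sub
    (((dt.hasFDerivAt (x := w)).const_mul 16).mul (dx₂.hasFDerivAt (x := w))) using 1
  ext <;> simp <;> ring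

theorem hasFDerivAt_kaplanGrad₂ (w : ℝ × ℝ × ℝ) :
    HasFDerivAt kaplanGrad₂ ((4 * horizSq w) • dx₂ +
      (4 * w.2.1) • ((2 * w.1) • dx₁ + (2 * w.2.1) • dx₂) +
      ((16 * w.2.2) • dx₁ + (16 * w.1) • dt)) w := by
  convert! (((hasFDerivAt_horizSq w).const_mul 4).mul (dx₂.hasFDerivAt (x := w))).add
    (((dt.hasFDerivAt (x := w)).const_mul 16).mul (dx₁.hasFDerivAt (x := w))) using 1
  ext <;> simp <;> ring

theorem contDiff_horizSq : ContDiff ℝ 1 horizSq := by unfold horizSq; fun_prop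

theorem contDiff_kaplanFourth : ContDiff ℝ 1 kaplanFourth := by
  unfold kaplanFourth horizSq; fun_prop

theorem horizSq_nonneg (w : ℝ × ℝ × ℝ) : 0 ≤ horizSq w := by unfold horizSq; positivity

theorem kaplanFourth_nonneg (w : ℝ × ℝ × ℝ) : 0 ≤ kaplanFourth w := by
  unfold kaplanFourth; positivity

/-- First horizontal component of the test field `φ(|x|²) (x - k(N⁴) |x|² ∇_ℍ N⁴)`. -/
noncomputable def testField₁ (φ k : ℝ → ℝ) (w : ℝ × ℝ × ℝ) : ℝ :=
  φ (horizSq w) * (w.1 - k (kaplanFourth w) * (horizSq w * kaplanGrad₁ w))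

/-- Second horizontal component of the test field `φ(|x|²) (x - k(N⁴) |x|² ∇_ℍ N⁴)`. -/
noncomputable def testField₂ (φ k : ℝ → ℝ) (w : ℝ × ℝ × ℝ) : ℝ :=
  φ (horizSq w) * (w.2.1 - k (kaplanFourth w) * (horizSq w * kaplanGrad₂ w))

theorem divergence_testField {φ k : ℝ → ℝ} {φ' k' : ℝ} {w : ℝ × ℝ × ℝ}
    (hφ : HasDerivAt φ φ' (horizSq w)) (hk : HasDerivAt k k' (kaplanFourth w)) :
    X1 (testField₁ φ k) w + X2 (testField₂ φ k) w =
      φ' * (2 * horizSq w - 8 * k (kaplanFourth w) * horizSq w ^ 3) +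
        φ (horizSq w) * (2 - 16 * horizSq w ^ 2 *
          (kaplanFourth w * k' + 2 * k (kaplanFourth w))) := by
  have hs := hasFDerivAt_horizSq w
  have hΦ := hφ.comp_hasFDerivAt w hs
  have hK := hk.comp_hasFDerivAt w (hasFDerivAt_kaplanFourth w)
  have h1 := hΦ.mul ((dx₁.hasFDerivAt (x := w)).sub
    (hK.mul (hs.mul (hasFDerivAt_kaplanGrad₁ w))))
  have h2 := hΦ.mul ((dx₂.hasFDerivAt (x := w)).sub
    (hK.mul (hs.mul (hasFDerivAt_kaplanGrad₂ w))))
  have e1 : X1 (testField₁ φ k) w = _ := congrArg (fun L => L (1, 0, -(w.2.1) / 2)) h1.fderiv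
  have e2 : X2 (testField₂ φ k) w = _ := congrArg (fun L => L (0, 1, w.1 / 2)) h2.fderiv
  rw [e1, e2]
  simp only [Function.comp_apply, Pi.mul_apply, Pi.sub_apply, add_apply, sub_apply, smul_apply,
    dx₁_apply, dx₂_apply, dt_apply, smul_eq_mul]
  generalize k (kaplanFourth w) = K
  generalize φ (horizSq w) = Φ
  simp only [kaplanGrad₁, kaplanGrad₂, kaplanFourth, horizSq]
  ring

theorem testField_dot_kaplanGrad (φ k : ℝ → ℝ) (w : ℝ × ℝ × ℝ) :
    testField₁ φ k w * kaplanGrad₁ w + testField₂ φ k w * kaplanGrad₂ w =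
      4 * horizSq w ^ 2 * φ (horizSq w) * (1 - 4 * k (kaplanFourth w) * kaplanFourth w) := by
  unfold testField₁ testField₂
  generalize k (kaplanFourth w) = K
  generalize φ (horizSq w) = Φ
  simp only [kaplanGrad₁, kaplanGrad₂, kaplanFourth, horizSq]
  ring

theorem testField_sq_le {φ k : ℝ → ℝ} {w : ℝ × ℝ × ℝ} (hk0 : 0 ≤ k (kaplanFourth w))
    (hk1 : 4 * k (kaplanFourth w) * kaplanFourth w ≤ 1) :
    testField₁ φ k w ^ 2 + testField₂ φ k w ^ 2 ≤ φ (horizSq w) ^ 2 * horizSq w := by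
  have key : testField₁ φ k w ^ 2 + testField₂ φ k w ^ 2 = φ (horizSq w) ^ 2 * (horizSq w *
      (1 - 4 * k (kaplanFourth w) * horizSq w ^ 2 *
        (2 - 4 * k (kaplanFourth w) * kaplanFourth w))) := by
    unfold testField₁ testField₂
    generalize k (kaplanFourth w) = K
    generalize φ (horizSq w) = Φ
    simp only [kaplanGrad₁, kaplanGrad₂, kaplanFourth, horizSq]
    ring
  rw [key]
  have h0 := horizSq_nonneg w
  have : 0 ≤ 4 * k (kaplanFourth w) * horizSq w ^ 2 *
      (2 - 4 * k (kaplanFourth w) * kaplanFourth w) :=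
    mul_nonneg (by positivity) (by linarith)
  refine mul_le_mul_of_nonneg_left (mul_le_of_le_one_right h0 (by linarith)) (sq_nonneg _)

/-- The unnormalised weight `e^{-N^p}`. -/
noncomputable def kaplanWeight (p : ℝ) (w : ℝ × ℝ × ℝ) : ℝ := Real.exp (-(KaplanH w) ^ p)

/-- The planar vector `(|x|², 4t)`, whose Euclidean norm is the square of the Kaplan norm. -/
noncomputable def kaplanVec (w : ℝ × ℝ × ℝ) : EuclideanSpace ℝ (Fin 2) :=
  !₂[horizSq w, 4 * w.2.2]

theorem contDiff_kaplanVec : ContDiff ℝ 1 kaplanVec := by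
  rw [contDiff_euclidean]
  intro i
  fin_cases i
  · simpa [kaplanVec] using contDiff_horizSq
  · simp [kaplanVec]; fun_prop

theorem norm_kaplanVec_sq (w : ℝ × ℝ × ℝ) : ‖kaplanVec w‖ ^ 2 = kaplanFourth w := by
  rw [EuclideanSpace.norm_sq_eq]
  simp [Fin.sum_univ_two, kaplanFourth, kaplanVec]
  ring

theorem kaplanWeight_eq (p : ℝ) :
    kaplanWeight p = fun w => Real.exp (-‖kaplanVec w‖ ^ (p / 2)) := by
  funext w
  have h1 : KaplanH w = kaplanFourth w ^ ((1 : ℝ) / 4) := rfl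
  rw [kaplanWeight, h1, ← norm_kaplanVec_sq, ← Real.rpow_natCast, ← Real.rpow_mul (norm_nonneg _),
    ← Real.rpow_mul (norm_nonneg _)]
  push_cast
  ring_nf

theorem contDiff_kaplanWeight {p : ℝ} (hp : 2 < p) : ContDiff ℝ 1 (kaplanWeight p) := by
  rw [kaplanWeight_eq]
  exact (contDiff_kaplanVec.norm_rpow (by linarith : 1 < p / 2)).neg.exp

theorem kaplanWeight_pos (p : ℝ) (w : ℝ × ℝ × ℝ) : 0 < kaplanWeight p w := Real.exp_pos _

theorem fderiv_kaplanWeight {p : ℝ} (hp : 2 < p) (w v : ℝ × ℝ × ℝ) :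
    fderiv ℝ (kaplanWeight p) w v = -(p / 4) * ‖kaplanVec w‖ ^ (p / 2 - 2) *
      (fderiv ℝ kaplanFourth w v) * kaplanWeight p w := by
  have hz := (contDiff_kaplanVec.differentiable one_ne_zero w).hasFDerivAt
  have h2 := hz.norm_sq.fderiv
  rw [funext norm_kaplanVec_sq] at h2
  have hexp := ((hasFDerivAt_norm_rpow (kaplanVec w) (by linarith : 1 < p / 2)).comp w hz).neg.exp
  rw [h2, kaplanWeight_eq]
  refine (congrArg (fun L => L v) hexp.fderiv).trans ?_
  simp
  ring

theorem X1_kaplanFourth (w : ℝ × ℝ × ℝ) : X1 kaplanFourth w = kaplanGrad₁ w := by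
  rw [X1, (hasFDerivAt_kaplanFourth w).fderiv]
  simp [kaplanGrad₁]
  ring

theorem X2_kaplanFourth (w : ℝ × ℝ × ℝ) : X2 kaplanFourth w = kaplanGrad₂ w := by
  rw [X2, (hasFDerivAt_kaplanFourth w).fderiv]
  simp [kaplanGrad₂]
  ring

theorem X1_kaplanWeight {p : ℝ} (hp : 2 < p) (w : ℝ × ℝ × ℝ) : X1 (kaplanWeight p) w =
    -(p / 4) * ‖kaplanVec w‖ ^ (p / 2 - 2) * kaplanGrad₁ w * kaplanWeight p w := by
  rw [← X1_kaplanFourth]; exact fderiv_kaplanWeight hp w _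

theorem X2_kaplanWeight {p : ℝ} (hp : 2 < p) (w : ℝ × ℝ × ℝ) : X2 (kaplanWeight p) w =
    -(p / 4) * ‖kaplanVec w‖ ^ (p / 2 - 2) * kaplanGrad₂ w * kaplanWeight p w := by
  rw [← X2_kaplanFourth]; exact fderiv_kaplanWeight hp w _

theorem X1_mul {g h : ℝ × ℝ × ℝ → ℝ} (hg : Differentiable ℝ g) (hh : Differentiable ℝ h)
    (w : ℝ × ℝ × ℝ) : X1 (g * h) w = g w * X1 h w + h w * X1 g w := by
  simp [X1, fderiv_mul (hg w) (hh w)]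

theorem X2_mul {g h : ℝ × ℝ × ℝ → ℝ} (hg : Differentiable ℝ g) (hh : Differentiable ℝ h)
    (w : ℝ × ℝ × ℝ) : X2 (g * h) w = g w * X2 h w + h w * X2 g w := by
  simp [X2, fderiv_mul (hg w) (hh w)]

theorem fderiv_abs_rpow {f : ℝ × ℝ × ℝ → ℝ} (hf : Differentiable ℝ f) {q : ℝ} (hq : 1 < q)
    (w v : ℝ × ℝ × ℝ) :
    fderiv ℝ (fun w => |f w| ^ q) w v = q * |f w| ^ (q - 2) * f w * fderiv ℝ f w v := by
  have h : fderiv ℝ (fun w => |f w| ^ q) w = _ :=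
    ((hasDerivAt_abs_rpow (f w) hq).comp_hasFDerivAt w (hf w).hasFDerivAt).fderiv
  rw [h]
  simp

theorem continuous_X1 {f : ℝ × ℝ × ℝ → ℝ} (hf : ContDiff ℝ 1 f) : Continuous (X1 f) :=
  (hf.continuous_fderiv one_ne_zero).clm_apply (by fun_prop)

theorem continuous_X2 {f : ℝ × ℝ × ℝ → ℝ} (hf : ContDiff ℝ 1 f) : Continuous (X2 f) :=
  (hf.continuous_fderiv one_ne_zero).clm_apply (by fun_prop)

theorem X1_eq_zero {f : ℝ × ℝ × ℝ → ℝ} {w : ℝ × ℝ × ℝ} (hw : w ∉ tsupport f) : X1 f w = 0 := by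
  simp [X1, fderiv_of_notMem_tsupport ℝ hw]

theorem X2_eq_zero {f : ℝ × ℝ × ℝ → ℝ} {w : ℝ × ℝ × ℝ} (hw : w ∉ tsupport f) : X2 f w = 0 := by
  simp [X2, fderiv_of_notMem_tsupport ℝ hw]

theorem integral_fderiv_eq_zero {h : ℝ × ℝ × ℝ → ℝ} (hh : ContDiff ℝ 1 h)
    (hc : HasCompactSupport h) (v : ℝ × ℝ × ℝ) : ∫ w, fderiv ℝ h w v = 0 := by
  have hi : Integrable (fun w => fderiv ℝ h w v) :=
    ((hh.continuous_fderiv one_ne_zero).clm_apply continuous_const).integrable_of_hasCompactSupport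
      (hc.fderiv_apply (𝕜 := ℝ) v)
  have : (volume : Measure (ℝ × ℝ × ℝ)).IsAddHaarMeasure :=
    Measure.prod.instIsAddHaarMeasure _ _
  have := integral_mul_fderiv_eq_neg_fderiv_mul_of_integrable (μ := volume)
    (f := fun _ : ℝ × ℝ × ℝ => (1 : ℝ)) (g := h) (v := v) (by simp) (by simpa using hi)
    (by simpa using hh.continuous.integrable_of_hasCompactSupport hc) (by fun_prop)
    (fun w _ => hh.differentiable one_ne_zero w)
  simpa using this

/-- A field `∂_v + ℓ ∂_t` with `ℓ` linear and independent of `t` is divergence free. -/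
theorem integral_fderiv_add_smul_eq_zero {h : ℝ × ℝ × ℝ → ℝ} (hh : ContDiff ℝ 1 h)
    (hc : HasCompactSupport h) (v : ℝ × ℝ × ℝ) (l : ℝ × ℝ × ℝ →L[ℝ] ℝ) (hl : l (0, 0, 1) = 0) :
    ∫ w, fderiv ℝ h w (v + l w • (0, 0, 1)) = 0 := by
  have hlh : ContDiff ℝ 1 (⇑l * h) := l.contDiff.mul hh
  have hlc : HasCompactSupport (⇑l * h) := hc.mul_left
  have key : ∀ w, fderiv ℝ h w (v + l w • (0, 0, 1)) =
      fderiv ℝ h w v + fderiv ℝ (⇑l * h) w (0, 0, 1) := by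
    intro w
    rw [fderiv_mul l.differentiableAt (hh.differentiable one_ne_zero w)]
    rw [map_add, map_smul]
    simp [hl]
  simp_rw [key]
  rw [integral_add, integral_fderiv_eq_zero hh hc, integral_fderiv_eq_zero hlh hlc, add_zero]
  · exact ((hh.continuous_fderiv one_ne_zero).clm_apply
      continuous_const).integrable_of_hasCompactSupport (hc.fderiv_apply (𝕜 := ℝ) v)
  · exact ((hlh.continuous_fderiv one_ne_zero).clm_apply
      continuous_const).integrable_of_hasCompactSupport (hlc.fderiv_apply (𝕜 := ℝ) _)

theorem integral_X1_eq_zero {h : ℝ × ℝ × ℝ → ℝ} (hh : ContDiff ℝ 1 h)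
    (hc : HasCompactSupport h) : ∫ w, X1 h w = 0 := by
  rw [← integral_fderiv_add_smul_eq_zero hh hc (1, 0, 0) (-(1 / 2 : ℝ) • dx₂) (by simp)]
  refine integral_congr_ae (Filter.Eventually.of_forall fun w => ?_)
  simp only [X1]
  congr 1
  ext <;> simp
  ring

theorem integral_X2_eq_zero {h : ℝ × ℝ × ℝ → ℝ} (hh : ContDiff ℝ 1 h)
    (hc : HasCompactSupport h) : ∫ w, X2 h w = 0 := by
  rw [← integral_fderiv_add_smul_eq_zero hh hc (0, 1, 0) ((1 / 2 : ℝ) • dx₁) (by simp)]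
  refine integral_congr_ae (Filter.Eventually.of_forall fun w => ?_)
  simp only [X2]
  congr 1
  ext <;> simp
  ring

theorem contDiff_testField₁ {φ k : ℝ → ℝ} (hφ : ContDiff ℝ 1 fun w => φ (horizSq w))
    (hk : ContDiff ℝ 1 k) : ContDiff ℝ 1 (testField₁ φ k) := by
  have hk' := hk.comp contDiff_kaplanFourth
  have h1 : ContDiff ℝ 1 kaplanGrad₁ := by unfold kaplanGrad₁ horizSq; fun_prop
  exact hφ.mul (contDiff_fst.sub (hk'.mul (contDiff_horizSq.mul h1)))

theorem contDiff_testField₂ {φ k : ℝ → ℝ} (hφ : ContDiff ℝ 1 fun w => φ (horizSq w))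
    (hk : ContDiff ℝ 1 k) : ContDiff ℝ 1 (testField₂ φ k) := by
  have hk' := hk.comp contDiff_kaplanFourth
  have h1 : ContDiff ℝ 1 kaplanGrad₂ := by unfold kaplanGrad₂ horizSq; fun_prop
  exact hφ.mul ((contDiff_fst.comp contDiff_snd).sub (hk'.mul (contDiff_horizSq.mul h1)))

theorem integral_muH (p : ℝ) (g : ℝ × ℝ × ℝ → ℝ) : ∫ w, g w ∂(muH p) =
    (∫ v : ℝ × ℝ × ℝ, Real.exp (-(KaplanH v) ^ p))⁻¹ * ∫ w, kaplanWeight p w * g w := by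
  have hm : Measurable (fun w : ℝ × ℝ × ℝ => KaplanH w) := by unfold KaplanH; fun_prop
  have hZ : 0 ≤ (∫ v : ℝ × ℝ × ℝ, Real.exp (-(KaplanH v) ^ p))⁻¹ :=
    inv_nonneg.2 (integral_nonneg fun _ => (Real.exp_pos _).le)
  rw [muH, integral_withDensity_eq_integral_toReal_smul (by fun_prop) (by simp),
    ← integral_const_mul]
  refine integral_congr_ae (Filter.Eventually.of_forall fun w => ?_)
  simp only [smul_eq_mul]
  rw [ENNReal.toReal_ofReal (mul_nonneg hZ (Real.exp_pos _).le), mul_assoc]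
  rfl

/-- Pointwise lower bound for the divergence of the test field times `|f|^q e^{-N^p}`. -/
theorem pointwise_divergence_bound {p q e ε : ℝ} {j : ℕ} (hp : 2 < p) (hq1 : 1 < q) (hq2 : q < 2)
    (hj : p / 2 ≤ 4 * j + 4) (hε0 : 0 < ε) (hε1 : ε ≤ 1) (he : e = ε ^ (2 / q))
    {f : ℝ × ℝ × ℝ → ℝ} (hf : ContDiff ℝ 1 f) (w : ℝ × ℝ × ℝ)
    (h₁ : ContDiff ℝ 1 (testField₁ (fun s => e / (e + s)) (profile j)))
    (h₂ : ContDiff ℝ 1 (testField₂ (fun s => e / (e + s)) (profile j))) :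
    1 / 4 * (kaplanWeight p w * |f w| ^ q) -
        (p + 8 * j + 13) * ε⁻¹ * (kaplanWeight p w * (horizSq w ^ (q / 2) * |f w| ^ q)) -
        4 * ε * (kaplanWeight p w * (X1 f w ^ 2 + X2 f w ^ 2) ^ (q / 2)) ≤
      X1 (testField₁ (fun s => e / (e + s)) (profile j) *
          ((fun w => |f w| ^ q) * kaplanWeight p)) w +
        X2 (testField₂ (fun s => e / (e + s)) (profile j) *
          ((fun w => |f w| ^ q) * kaplanWeight p)) w := by
  have he0 : 0 < e := he ▸ Real.rpow_pos_of_pos hε0 _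
  have hs := horizSq_nonneg w
  have hρ := kaplanFourth_nonneg w
  have hF : ContDiff ℝ 1 fun w => |f w| ^ q := by
    simpa [Real.norm_eq_abs] using hf.norm_rpow hq1
  have hW := contDiff_kaplanWeight hp
  have hdF := hF.differentiable one_ne_zero
  have hdW := hW.differentiable one_ne_zero
  have hdf := hf.differentiable one_ne_zero
  rw [X1_mul (h₁.differentiable one_ne_zero) (hdF.mul hdW),
    X2_mul (h₂.differentiable one_ne_zero) (hdF.mul hdW), X1_mul hdF hdW, X2_mul hdF hdW,
    X1_kaplanWeight hp, X2_kaplanWeight hp,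
    show X1 (fun w => |f w| ^ q) w = q * |f w| ^ (q - 2) * f w * X1 f w from
      fderiv_abs_rpow hdf hq1 w _,
    show X2 (fun w => |f w| ^ q) w = q * |f w| ^ (q - 2) * f w * X2 f w from
      fderiv_abs_rpow hdf hq1 w _]
  obtain ⟨d, hd, hd'⟩ := exists_hasDerivAt_profile j hρ
  have hφ : HasDerivAt (fun s => e / (e + s)) (-e / (e + horizSq w) ^ 2) (horizSq w) :=
    ((hasDerivAt_const (horizSq w) e).fun_div ((hasDerivAt_id' (horizSq w)).const_add e)
      (by positivity)).congr_deriv (by simp)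
  have hdiv := divergence_testField (w := w) hφ hd
  have hdot := testField_dot_kaplanGrad (fun s => e / (e + s)) (profile j) w
  have hk1 : 4 * profile j (kaplanFourth w) * kaplanFourth w ≤ 1 := by
    have := four_mul_profile_mul j (kaplanFourth w)
    have h0 : 0 < 1 / (1 + kaplanFourth w ^ (2 * j + 2)) := by positivity
    linarith
  have hsq : testField₁ (fun s => e / (e + s)) (profile j) w ^ 2 +
      testField₂ (fun s => e / (e + s)) (profile j) w ^ 2 ≤ e := by
    refine (testField_sq_le (profile_nonneg j hρ) hk1).trans ?_
    rw [div_pow, div_mul_eq_mul_div, div_le_iff₀ (by positivity)]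
    nlinarith [mul_nonneg he0.le hs, mul_nonneg he0.le (mul_nonneg he0.le hs),
      mul_nonneg he0.le (mul_nonneg hs hs), pow_pos he0 3]
  have hsR : horizSq w ≤ ‖kaplanVec w‖ := by
    refine le_of_sq_le_sq ?_ (norm_nonneg _)
    rw [norm_kaplanVec_sq, kaplanFourth]
    nlinarith [sq_nonneg w.2.2]
  have hlow := divergence_lower_bound (d := d) hp hq1 hq2 hj hε0 hε1 he hs hsR rfl
    (by rw [norm_kaplanVec_sq]; exact hd')
  rw [norm_kaplanVec_sq] at hlow
  set a := testField₁ (fun s => e / (e + s)) (profile j) w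
  set b := testField₂ (fun s => e / (e + s)) (profile j) w
  set A := X1 f w
  set B := X2 f w
  have hcs : |a * A + b * B| ≤ (e * (A ^ 2 + B ^ 2)) ^ (1 / 2 : ℝ) := by
    rw [← Real.sqrt_eq_rpow]
    refine Real.abs_le_sqrt ?_
    have : (a ^ 2 + b ^ 2) * (A ^ 2 + B ^ 2) ≤ e * (A ^ 2 + B ^ 2) := by gcongr
    nlinarith [sq_nonneg (a * B - b * A)]
  have hyoung := young_cross_term hq1 hq2
    (Real.rpow_nonneg (by positivity : 0 ≤ e * (A ^ 2 + B ^ 2)) (1 / 2 : ℝ)) (abs_nonneg (f w))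
  have heq : e ^ (q / 2) = ε := by
    rw [he, ← Real.rpow_mul hε0.le, show 2 / q * (q / 2) = 1 by field_simp, Real.rpow_one]
  rw [← Real.rpow_mul (by positivity), show 1 / 2 * q = q / 2 by ring,
    Real.mul_rpow he0.le (z := q / 2) (by positivity), heq] at hyoung
  have hcross : -(4 * (ε * (A ^ 2 + B ^ 2) ^ (q / 2)) + |f w| ^ q / 4) ≤
      q * |f w| ^ (q - 2) * f w * (a * A + b * B) := by
    refine neg_le_of_abs_le (le_trans ?_ hyoung)
    have h1 : |f w| ^ (q - 2) * |f w| = |f w| ^ (q - 1) := by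
      rw [← Real.rpow_add_one' (abs_nonneg _) (by linarith)]
      ring_nf
    rw [abs_mul, abs_mul, abs_mul, abs_of_pos (by linarith : 0 < q),
      abs_of_nonneg (Real.rpow_nonneg (abs_nonneg (f w)) _), mul_assoc q, h1, mul_assoc,
      mul_comm (|f w| ^ (q - 1))]
    gcongr
  have hwpos := kaplanWeight_pos p w
  have hFw : 0 ≤ |f w| ^ q := Real.rpow_nonneg (abs_nonneg _) _
  have hfin := mul_le_mul_of_nonneg_right
    (add_le_add (mul_le_mul_of_nonneg_right hlow hFw) hcross) hwpos.le
  refine le_of_eq_of_le ?_ (hfin.trans_eq ?_)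
  · ring
  · have e1 : X1 (testField₁ (fun s => e / (e + s)) (profile j)) w = _ :=
      eq_sub_of_add_eq hdiv
    rw [e1]
    simp only [Pi.mul_apply]
    linear_combination (p / 4 * ‖kaplanVec w‖ ^ (p / 2 - 2) * |f w| ^ q * kaplanWeight p w) * hdot

theorem integrable_kaplanWeight_mul {p : ℝ} (hp : 2 < p) {f g : ℝ × ℝ × ℝ → ℝ}
    (hf : HasCompactSupport f) (hg : Continuous g) (h0 : ∀ w ∉ tsupport f, g w = 0) :
    Integrable fun w => kaplanWeight p w * g w :=
  ((contDiff_kaplanWeight hp).continuous.mul hg).integrable_of_hasCompactSupport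
    (HasCompactSupport.intro hf fun w hw => by simp [h0 w hw])

/-- Dimension-free `L^q` Hardy-type inequality on the Heisenberg group for
`dμ = Z⁻¹ e^{-N^p} dξ`, `p > 2`, `q = p/(p-1)`:
`∫ |f|^q dμ ≤ C(ε ∫ |∇_ℍ f|^q dμ + ε⁻¹ ∫ |x|^q |f|^q dμ)` for all `ε ∈ (0,1]`. -/
theorem hardy_Lq_heisenberg (p q : ℝ) (hp : 2 < p) (hq : q = p / (p - 1)) :
    ∃ C > 0, ∀ ε : ℝ, ε ∈ Set.Ioc (0 : ℝ) 1 →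
      ∀ f : ℝ × ℝ × ℝ → ℝ, ContDiff ℝ (⊤ : ℕ∞) f → HasCompactSupport f →
      ∫ w, |f w| ^ q ∂(muH p) ≤
        C * (ε * (∫ w, ((X1 f w) ^ 2 + (X2 f w) ^ 2) ^ (q / 2) ∂(muH p)) +
             ε⁻¹ * (∫ w, (w.1 ^ 2 + w.2.1 ^ 2) ^ (q / 2) * |f w| ^ q ∂(muH p))) := by
  have hq1 : 1 < q := by rw [hq, lt_div_iff₀ (by linarith)]; linarith
  have hq2 : q < 2 := by rw [hq, div_lt_iff₀ (by linarith)]; linarith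
  obtain ⟨j, hj⟩ := exists_nat_ge p
  have hj' : p / 2 ≤ 4 * j + 4 := by linarith
  refine ⟨16 + 4 * (p + 8 * j + 13), by positivity, fun ε hε f hf hc => ?_⟩
  obtain ⟨hε0, hε1⟩ := hε
  have hf1 : ContDiff ℝ 1 f := hf.of_le (by exact_mod_cast le_top)
  obtain ⟨e, he⟩ : ∃ e, e = ε ^ (2 / q) := ⟨_, rfl⟩
  have he0 : 0 < e := he ▸ Real.rpow_pos_of_pos hε0 _
  have hφ : ContDiff ℝ 1 fun w => e / (e + horizSq w) :=
    contDiff_const.div (contDiff_const.add contDiff_horizSq) fun w =>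
      (add_pos_of_pos_of_nonneg he0 (horizSq_nonneg w)).ne'
  have h₁ := contDiff_testField₁ (φ := fun s => e / (e + s)) hφ (contDiff_profile j)
  have h₂ := contDiff_testField₂ (φ := fun s => e / (e + s)) hφ (contDiff_profile j)
  have hF : ContDiff ℝ 1 fun w => |f w| ^ q := by
    simpa [Real.norm_eq_abs] using hf1.norm_rpow hq1
  have hF0 : ∀ w ∉ tsupport f, |f w| ^ q = 0 := fun w hw => by
    simp [image_eq_zero_of_notMem_tsupport hw, (by linarith : q ≠ 0)]
  have hFc : HasCompactSupport ((fun w => |f w| ^ q) * kaplanWeight p) :=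
    HasCompactSupport.intro hc fun w hw => by simp [hF0 w hw]
  have hG := hF.mul (contDiff_kaplanWeight hp)
  have hi₁ := integral_X1_eq_zero (h₁.mul hG) hFc.mul_left
  have hi₂ := integral_X2_eq_zero (h₂.mul hG) hFc.mul_left
  have hI₁ := (continuous_X1 (h₁.mul hG)).integrable_of_hasCompactSupport (μ := volume)
    (HasCompactSupport.intro hFc.mul_left fun w hw => X1_eq_zero hw)
  have hI₂ := (continuous_X2 (h₂.mul hG)).integrable_of_hasCompactSupport (μ := volume)
    (HasCompactSupport.intro hFc.mul_left fun w hw => X2_eq_zero hw)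
  have hI0 := integrable_kaplanWeight_mul hp hc hF.continuous hF0
  have hIx := integrable_kaplanWeight_mul hp hc
    ((contDiff_horizSq.continuous.rpow_const fun w => Or.inr (by linarith : 0 ≤ q / 2)).mul
      hF.continuous) fun w hw => by simp [hF0 w hw]
  have hIg := integrable_kaplanWeight_mul hp hc
    ((((continuous_X1 hf1).pow 2).add ((continuous_X2 hf1).pow 2)).rpow_const
      fun w => Or.inr (by linarith : 0 ≤ q / 2)) fun w hw => by
        simp [X1_eq_zero hw, X2_eq_zero hw, (by linarith : q ≠ 0)]
  have hle := integral_mono (((hI0.const_mul (1 / 4)).sub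
    (hIx.const_mul ((p + 8 * j + 13) * ε⁻¹))).sub (hIg.const_mul (4 * ε))) (hI₁.add hI₂)
    fun w => pointwise_divergence_bound hp hq1 hq2 hj' hε0 hε1 he hf1 w h₁ h₂
  rw [integral_add' hI₁ hI₂, hi₁, hi₂,
    integral_sub' ((hI0.const_mul _).sub (hIx.const_mul _)) (hIg.const_mul _),
    integral_sub' (hI0.const_mul _) (hIx.const_mul _), integral_const_mul, integral_const_mul,
    integral_const_mul] at hle
  rw [integral_muH, integral_muH, integral_muH]
  set Z := (∫ v : ℝ × ℝ × ℝ, Real.exp (-(KaplanH v) ^ p))⁻¹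
  have hZ : 0 ≤ Z := inv_nonneg.2 (integral_nonneg fun _ => (Real.exp_pos _).le)
  have hg0 : 0 ≤ ∫ w, kaplanWeight p w * (X1 f w ^ 2 + X2 f w ^ 2) ^ (q / 2) :=
    integral_nonneg fun w => mul_nonneg (kaplanWeight_pos p w).le (by positivity)
  have hx0 : 0 ≤ ∫ w, kaplanWeight p w * (horizSq w ^ (q / 2) * |f w| ^ q) :=
    integral_nonneg fun w => mul_nonneg (kaplanWeight_pos p w).le
      (mul_nonneg (Real.rpow_nonneg (horizSq_nonneg w) _) (by positivity))
  change _ ≤ _ * (_ + ε⁻¹ * (Z * ∫ w, kaplanWeight p w * (horizSq w ^ (q / 2) * |f w| ^ q)))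
  set I := ∫ w, kaplanWeight p w * |f w| ^ q
  set J := ∫ w, kaplanWeight p w * (X1 f w ^ 2 + X2 f w ^ 2) ^ (q / 2)
  set K := ∫ w, kaplanWeight p w * (horizSq w ^ (q / 2) * |f w| ^ q)
  change 1 / 4 * I - (p + 8 * j + 13) * ε⁻¹ * K - 4 * ε * J ≤ 0 + 0 at hle
  have hmain : I ≤ (16 + 4 * (p + 8 * j + 13)) * (ε * J + ε⁻¹ * K) := by
    have h1 : 0 ≤ 4 * (p + 8 * j + 13) * (ε * J) := by positivity
    have h2 : 0 ≤ 16 * (ε⁻¹ * K) := by positivity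
    linarith
  calc Z * I ≤ Z * ((16 + 4 * (p + 8 * j + 13)) * (ε * J + ε⁻¹ * K)) := by gcongr
    _ = _ := by ring
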